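/- Let a_1, a_2, a_3, a_4 be positive integers with a_1 + a_2 + a_3 + a_4 even. Then there exists a cyclic shift (b_1, b_2, b_3, b_4) of the sequence (a_1, a_2, a_3, a_4) such that the binary word 1 0^{b_1} 1 0^{b_2} 1 0^{b_3} 1 0^{b_4} is a shuffle square. -/

import Mathlib

/-- `Interleave x y z` means that `z` is an interleaving (shuffle) of the words
`x` and `y`. -/
inductive Interleave {α : Type*} : List α → List α → List α → Prop
  | nil : Interleave [] [] []
  | cons_left (a : α) {xs ys zs : List α} :
      Interleave xs ys zs → Interleave (a :: xs) ys (a :: zs)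
  | cons_right (a : α) {xs ys zs : List α} :
      Interleave xs ys zs → Interleave xs (a :: ys) (a :: zs)

/-- A word is a shuffle square if it is an interleaving of two copies of the same word. -/
def IsShuffleSquare {α : Type*} (w : List α) : Prop :=
  ∃ x : List α, Interleave x x w

/-- The word `1 0^{b₁} 1 0^{b₂} 1 0^{b₃} 1 0^{b₄}`. -/
def sepOnesWord (b₁ b₂ b₃ b₄ : ℕ) : List Bool :=
  [true] ++ List.replicate b₁ false ++ [true] ++ List.replicate b₂ false ++
    [true] ++ List.replicate b₃ false ++ [true] ++ List.replicate b₄ false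

theorem Interleave.append {α : Type*} {x y z x' y' z' : List α}
    (h : Interleave x y z) (h' : Interleave x' y' z') :
    Interleave (x ++ x') (y ++ y') (z ++ z') := by
  induction h with
  | nil => exact h'
  | cons_left a _ ih => exact ih.cons_left a
  | cons_right a _ ih => exact ih.cons_right a

theorem Interleave.left {α : Type*} (x : List α) : Interleave x [] x := by
  induction x with
  | nil => exact .nil
  | cons a _ ih => exact ih.cons_left a

theorem Interleave.right {α : Type*} (x : List α) : Interleave [] x x := by
  induction x with
  | nil => exact .nil
  | cons a _ ih => exact ih.cons_right a

theorem Interleave.replicate {α : Type*} (a : α) (m n : ℕ) :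
    Interleave (List.replicate m a) (List.replicate n a) (List.replicate (m + n) a) := by
  simpa [List.replicate_add, -List.replicate_append_replicate] using
    (Interleave.left (List.replicate m a)).append (Interleave.right (List.replicate n a))

/-- If the ones are assigned alternately to the two copies, the zeros can be balanced. -/
theorem isShuffleSquare_sepOnesWord_of_alternating {a b c d : ℕ} (hc : 0 < c)
    (habc : a ≤ b + c) (hcabd : c ≤ a + b + d) (heven : Even (a + b + c + d)) :
    IsShuffleSquare (sepOnesWord a b c d) := by
  obtain ⟨b₁, b₂, c₁, c₂, d₁, d₂, rfl, rfl, rfl, hp, rfl⟩ : ∃ b₁ b₂ c₁ c₂ d₁ d₂ : ℕ,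
      b = b₁ + b₂ ∧ c = c₁ + c₂ ∧ d = d₁ + d₂ ∧ a + b₁ = b₂ + c₂ ∧ d₂ = c₁ + d₁ := by
    obtain ⟨c₂, h₁, h₂, h₃, h₄, h₅⟩ : ∃ c₂, a ≤ b + c₂ ∧ c ≤ d + c₂ ∧ c₂ ≤ c ∧ c₂ ≤ a + b ∧
        (a + b + c₂) % 2 = 0 := by
      have h : (a + b + c + d) % 2 = 0 := Nat.even_iff.mp heven
      by_cases h₁ : a ≤ b ∧ c ≤ d
      · exact ⟨(a + b) % 2, by omega⟩
      · exact ⟨max (a - b) (c - d), by omega⟩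
    have h : (a + b + c + d) % 2 = 0 := Nat.even_iff.mp heven
    exact ⟨(b + c₂ - a) / 2, b - (b + c₂ - a) / 2, c - c₂, c₂, (d + c₂ - c) / 2,
      d - (d + c₂ - c) / 2, by omega⟩
  refine ⟨[true] ++ List.replicate (a + b₁) false ++ [true] ++
    List.replicate (c₁ + d₁) false, ?_⟩
  have h := (((((((Interleave.left [true]).append
    (Interleave.left (List.replicate a false))).append (Interleave.right [true])).append
    (Interleave.replicate false b₁ b₂)).append (Interleave.left [true])).append
    (Interleave.replicate false c₁ c₂)).append (Interleave.right [true])).append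
    (Interleave.replicate false d₁ (c₁ + d₁))
  convert h using 1
  · simp [List.replicate_add, -List.replicate_append_replicate]
  · rw [hp]
    simp [List.replicate_add, -List.replicate_append_replicate]
  · rfl

/-- If the outer two ones are assigned to one copy and the inner two to the other,
the zeros can be balanced. -/
theorem isShuffleSquare_sepOnesWord_of_nested {a b c d : ℕ} (hc : 0 < c)
    (hab : a ≤ b) (hacbd : a + c ≤ b + d) (heven : Even (a + b + c + d)) :
    IsShuffleSquare (sepOnesWord a b c d) := by
  obtain ⟨b₁, b₂, c₁, c₂, d₁, d₂, rfl, rfl, rfl, rfl, rfl⟩ : ∃ b₁ b₂ c₁ c₂ d₁ d₂ : ℕ,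
      b = b₁ + b₂ ∧ c = c₁ + c₂ ∧ d = d₁ + d₂ ∧ b₂ = a + b₁ + c₁ ∧ d₁ = c₂ + d₂ := by
    obtain ⟨c₁, h₁, h₂, h₃, h₄⟩ : ∃ c₁, a + c₁ ≤ b ∧ c ≤ d + c₁ ∧ c₁ ≤ c ∧
        (a + b + c₁) % 2 = 0 := by
      have h : (a + b + c + d) % 2 = 0 := Nat.even_iff.mp heven
      exact ⟨min c (b - a) - (min c (b - a) + a + b) % 2, by omega⟩
    have h : (a + b + c + d) % 2 = 0 := Nat.even_iff.mp heven
    exact ⟨(b - a - c₁) / 2, b - (b - a - c₁) / 2, c₁, c - c₁, d - (d + c₁ - c) / 2,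
      (d + c₁ - c) / 2, by omega⟩
  refine ⟨[true] ++ List.replicate (a + b₁ + c₁) false ++ [true] ++
    List.replicate (c₂ + d₂) false, ?_⟩
  have h := (((((((Interleave.left [true]).append
    (Interleave.left (List.replicate a false))).append (Interleave.right [true])).append
    (Interleave.replicate false b₁ (a + b₁ + c₁))).append (Interleave.right [true])).append
    (Interleave.replicate false c₁ c₂)).append (Interleave.left [true])).append
    (Interleave.replicate false (c₂ + d₂) d₂)
  convert h using 1 <;> simp [sepOnesWord, List.replicate_add, -List.replicate_append_replicate]

theorem statement12 (a₁ a₂ a₃ a₄ : ℕ)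
    (h₁ : 0 < a₁) (h₂ : 0 < a₂) (h₃ : 0 < a₃) (h₄ : 0 < a₄)
    (heven : Even (a₁ + a₂ + a₃ + a₄)) :
    IsShuffleSquare (sepOnesWord a₁ a₂ a₃ a₄) ∨
    IsShuffleSquare (sepOnesWord a₂ a₃ a₄ a₁) ∨
    IsShuffleSquare (sepOnesWord a₃ a₄ a₁ a₂) ∨
    IsShuffleSquare (sepOnesWord a₄ a₁ a₂ a₃) := by
  have e₂ : Even (a₂ + a₃ + a₄ + a₁) := by convert heven using 1; ring
  have e₃ : Even (a₃ + a₄ + a₁ + a₂) := by convert heven using 1; ring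
  have e₄ : Even (a₄ + a₁ + a₂ + a₃) := by convert heven using 1; ring
  by_cases d₁ : a₂ + a₃ + a₄ < a₁
  · exact .inr (.inr (.inr (isShuffleSquare_sepOnesWord_of_nested h₂ (by omega) (by omega) e₄)))
  by_cases d₂ : a₃ + a₄ + a₁ < a₂
  · exact .inl (isShuffleSquare_sepOnesWord_of_nested h₃ (by omega) (by omega) heven)
  by_cases d₃ : a₄ + a₁ + a₂ < a₃
  · exact .inr (.inl (isShuffleSquare_sepOnesWord_of_nested h₄ (by omega) (by omega) e₂))
  by_cases d₄ : a₁ + a₂ + a₃ < a₄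
  · exact .inr (.inr (.inl (isShuffleSquare_sepOnesWord_of_nested h₁ (by omega) (by omega) e₃)))
  obtain h | h | h | h : a₁ ≤ a₂ + a₃ ∨ a₂ ≤ a₃ + a₄ ∨ a₃ ≤ a₄ + a₁ ∨ a₄ ≤ a₁ + a₂ := by
    omega
  · exact .inl (isShuffleSquare_sepOnesWord_of_alternating h₃ h (by omega) heven)
  · exact .inr (.inl (isShuffleSquare_sepOnesWord_of_alternating h₄ h (by omega) e₂))
  · exact .inr (.inr (.inl (isShuffleSquare_sepOnesWord_of_alternating h₁ h (by omega) e₃)))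
  · exact .inr (.inr (.inr (isShuffleSquare_sepOnesWord_of_alternating h₂ h (by omega) e₄)))
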